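/- arXiv:2511.13976 — 2 statements merged into one kernel-verified Lean document; each statement's English description precedes it below -/
import Mathlib

section
/- Let V be a finite-dimensional real vector space with a symmetric bilinear form B and a B-orthogonal direct sum decomposition V = P ⊕ N, with B positive definite on P, B negative definite on N, and dim P = 1. Let ω ∈ V with B(ω,ω) > 0, and let t be a real number with 0 ≤ t < 1/2. Suppose K, L ∈ V satisfy B(K,K) = 0, B(L,L) − B(K,L) ≥ 0, B(K,L) ≥ 0, and B(L,ω) = t·B(K,ω). Then B(L,L) = B(K,L) = 0 and L = t·K. -/
/-- Abstract form of the intersection-theoretic argument for `E(1)_{m,n}`: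
in a space of signature `(1,n)`, if `B(K,K) = 0`, `B(L,L) - B(K,L) ≥ 0`,
`B(K,L) ≥ 0` and `B(L,ω) = t·B(K,ω)` with `0 ≤ t < 1/2` and `B(ω,ω) > 0`,
then `B(L,L) = B(K,L) = 0` and `L = t·K`. -/
theorem elliptic_surface_line_bundle_proportional
    (V : Type*) [AddCommGroup V] [Module ℝ V] [FiniteDimensional ℝ V]
    (B : LinearMap.BilinForm ℝ V) (hB : B.IsSymm)
    (P N : Submodule ℝ V) (hcompl : IsCompl P N)
    (horth : ∀ p ∈ P, ∀ n ∈ N, B p n = 0)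
    (hP : ∀ v ∈ P, v ≠ 0 → 0 < B v v)
    (hN : ∀ v ∈ N, v ≠ 0 → B v v < 0)
    (hdim : Module.finrank ℝ P = 1)
    (ω : V) (hω : 0 < B ω ω)
    (t : ℝ) (ht0 : 0 ≤ t) (ht1 : t < 1/2)
    (K L : V)
    (hK : B K K = 0)
    (hL : 0 ≤ B L L - B K L)
    (hKL : 0 ≤ B K L)
    (hdeg : B L ω = t * B K ω) :
    B L L = 0 ∧ B K L = 0 ∧ L = t • K := by
  have key : ∀ D : V, B D ω = 0 → 0 ≤ B D D → D = 0 := by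
    intro D hDω hDD
    have hNz : ∀ v ∈ N, 0 ≤ B v v → v = 0 := by
      intro v hv h
      by_contra hne
      exact absurd (hN v hv hne) (not_lt.mpr h)
    obtain ⟨e, he0, he⟩ := finrank_eq_one_iff'.mp hdim
    have hdec : ∀ x : V, ∃ c : ℝ, ∃ n ∈ N, x = c • (e : V) + n := by
      intro x
      have hx : x ∈ P ⊔ N := by rw [hcompl.sup_eq_top]; trivial
      obtain ⟨p, hp, n, hn, rfl⟩ := Submodule.mem_sup.mp hx
      obtain ⟨c, hc⟩ := he ⟨p, hp⟩
      refine ⟨c, n, hn, ?_⟩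
      have h2 : c • (e : V) = p := congrArg Subtype.val hc
      rw [h2]
    obtain ⟨a, n₁, hn₁, h₁⟩ := hdec ω
    obtain ⟨b, n₂, hn₂, h₂⟩ := hdec D
    have hωD : B ω D = 0 := by rw [← hDω]; exact hB.eq ω D
    have hvN : a • D - b • ω ∈ N := by
      have h3 : a • D - b • ω = a • n₂ - b • n₁ := by
        rw [h₁, h₂]; module
      rw [h3]
      exact N.sub_mem (N.smul_mem _ hn₂) (N.smul_mem _ hn₁)
    have hvv : B (a • D - b • ω) (a • D - b • ω) = a ^ 2 * B D D + b ^ 2 * B ω ω := by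
      simp [hωD, hDω]; ring
    have hv0 : a • D - b • ω = 0 := hNz _ hvN (by rw [hvv]; positivity)
    rw [hv0] at hvv
    have hb : b = 0 := by
      by_contra hne
      have h4 : 0 < b ^ 2 * B ω ω := by positivity
      have h5 : 0 ≤ a ^ 2 * B D D := by positivity
      simp only [map_zero] at hvv
      linarith
    apply hNz D _ hDD
    rw [h₂, hb]; simpa using hn₂
  have hLK : B L K = B K L := hB.eq L K
  have hD : L - t • K = 0 := by
    apply key
    · simp [hdeg]
    · have h6 : B (L - t • K) (L - t • K) = B L L - 2 * t * B K L := by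
        simp [hLK, hK]; ring
      rw [h6]
      nlinarith [mul_nonneg (by linarith : (0:ℝ) ≤ 1 - 2 * t) hKL]
  have hLt : L = t • K := sub_eq_zero.mp hD
  refine ⟨?_, ?_, hLt⟩
  · rw [hLt]; simp [hK]
  · rw [hLt]; simp [hK]
end

section
/- Let V be a finite-dimensional real vector space with a symmetric bilinear form B. Suppose V = H ⊕ H' and V = P ⊕ P' are two B-orthogonal direct sum decompositions, with B positive definite on H and on P, B negative definite on H' and on P', and dim H = dim P. Let ρ_H : V → H and ρ_P : V → P denote the projections with kernels H' and P' respectively. If c ∈ V satisfies B(c,c) ≥ 0 and c ≠ 0, then ρ_H(ρ_P(c)) ≠ 0. -/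
/-- The key nonvanishing claim in the proof that the constant chamber equals the
zero chamber: given two `B`-orthogonal decompositions `V = H ⊕ H'` and
`V = P ⊕ P'` into positive and negative definite parts with `dim H = dim P`,
and `c ≠ 0` with `B(c,c) ≥ 0`, the composition of the two projections applied
to `c` is nonzero. -/
theorem proj_proj_ne_zero
    (V : Type*) [AddCommGroup V] [Module ℝ V] [FiniteDimensional ℝ V]
    (B : LinearMap.BilinForm ℝ V) (hB : B.IsSymm)
    (H H' : Submodule ℝ V) (hcomplH : IsCompl H H')
    (horthH : ∀ a ∈ H, ∀ c ∈ H', B a c = 0)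
    (hHpos : ∀ v ∈ H, v ≠ 0 → 0 < B v v)
    (hHneg : ∀ v ∈ H', v ≠ 0 → B v v < 0)
    (P P' : Submodule ℝ V) (hcomplP : IsCompl P P')
    (horthP : ∀ a ∈ P, ∀ c ∈ P', B a c = 0)
    (hPpos : ∀ v ∈ P, v ≠ 0 → 0 < B v v)
    (hPneg : ∀ v ∈ P', v ≠ 0 → B v v < 0)
    (hdim : Module.finrank ℝ H = Module.finrank ℝ P)
    (c : V) (hc : 0 ≤ B c c) (hc0 : c ≠ 0) :
    (H.linearProjOfIsCompl H' hcomplH ((P.linearProjOfIsCompl P' hcomplP c : V)) : V) ≠ 0 := by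
  intro h
  have h1 := (Submodule.projectionOnto_apply_eq_zero_iff hcomplH).1 (Subtype.ext h)
  by_cases h0 : P.projectionOnto P' hcomplP c = 0
  · have h2 := (Submodule.projectionOnto_apply_eq_zero_iff hcomplP).1 h0
    exact absurd (hPneg c h2 hc0) (not_lt.2 hc)
  · have hne : ((P.projectionOnto P' hcomplP c : P) : V) ≠ 0 := fun e => h0 (Subtype.ext e)
    exact lt_asymm (hPpos _ (P.projectionOnto P' hcomplP c).2 hne) (hHneg _ h1 hne)
end
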